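/- arXiv:1706.08782 — 7 statements merged into one kernel-verified Lean document; each statement's English description precedes it below -/
import Mathlib

section
/- For each i ∈ {1,2} and any two distinct states u_* ≠ u_**, the set {ρ > 0 : S_i(ρ, u_*) = S_i(ρ, u_**)} has at most two elements; that is, two shock curves of the same family intersect in at most two points. -/
noncomputable def Sc (a : ℝ) (i : ℕ) (ρ ρs qs : ℝ) : ℝ :=
  ρ * (qs/ρs + (-1 : ℝ)^i * a * (Real.sqrt (ρ/ρs) - Real.sqrt (ρs/ρ)))

noncomputable def Rc (a : ℝ) (i : ℕ) (ρ ρs qs : ℝ) : ℝ :=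
  ρ * (qs/ρs + (-1 : ℝ)^i * a * Real.log (ρ/ρs))

/-- In the square-root variables, the intersection condition determines `t` up to the
involution `t ↦ s * r / t`. -/
theorem eq_or_mul_eq_of_shock_strength_diff_eq {s r t u : ℝ} (hs : 0 < s) (hr : 0 < r)
    (ht : 0 < t) (hu : 0 < u) (hsr : s ≠ r)
    (h : (t / s - s / t) - (t / r - r / t) = (u / s - s / u) - (u / r - r / u)) :
    t = u ∨ t * u = s * r := by
  have key : (r - s) * ((t - u) * (t * u - s * r)) = 0 := by
    field_simp at h
    linear_combination h
  rcases mul_eq_zero.1 key with h1 | h1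
  · exact absurd (sub_eq_zero.1 h1).symm hsr
  · rcases mul_eq_zero.1 h1 with h2 | h2
    · exact Or.inl (sub_eq_zero.1 h2)
    · exact Or.inr (sub_eq_zero.1 h2)

/-- The intersection condition for two shock curves, with the terms independent of `ρ` on the
right. -/
theorem shock_strength_diff_eq {a : ℝ} (ha : 0 < a) {i : ℕ} {ρ ρs qs ρss qss : ℝ}
    (hρ : 0 < ρ) (h : Sc a i ρ ρs qs = Sc a i ρ ρss qss) :
    (√ρ / √ρs - √ρs / √ρ) - (√ρ / √ρss - √ρss / √ρ) =
      (qss / ρss - qs / ρs) / ((-1 : ℝ) ^ i * a) := by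
  have hk : (-1 : ℝ) ^ i * a ≠ 0 := mul_ne_zero (pow_ne_zero _ (by norm_num)) ha.ne'
  simp only [Sc, Real.sqrt_div' _ hρ.le, Real.sqrt_div hρ.le] at h
  have h' := mul_left_cancel₀ hρ.ne' h
  rw [eq_div_iff hk]
  linear_combination h'

theorem shock_curves_intersect_at_most_twice
    (a : ℝ) (ha : 0 < a) (i : ℕ) (hi : i ∈ ({1, 2} : Set ℕ))
    (ρs qs ρss qss : ℝ) (hρs : 0 < ρs) (hρss : 0 < ρss)
    (hne : (ρs, qs) ≠ (ρss, qss)) :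
    ∃ x y : ℝ, {ρ : ℝ | 0 < ρ ∧ Sc a i ρ ρs qs = Sc a i ρ ρss qss} ⊆ {x, y} := by
  by_cases hex : ∃ ρ₀ : ℝ, 0 < ρ₀ ∧ Sc a i ρ₀ ρs qs = Sc a i ρ₀ ρss qss
  · obtain ⟨ρ₀, hρ₀, h₀⟩ := hex
    have hρ_ne : ρs ≠ ρss := by
      rintro rfl
      have h := mul_left_cancel₀ hρ₀.ne' h₀
      exact hne (by rw [(div_left_inj' hρs.ne').1 (add_right_cancel h)])
    refine ⟨ρ₀, ρs * ρss / ρ₀, ?_⟩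
    rintro ρ ⟨hρ, h⟩
    have hsqrt : √ρs ≠ √ρss := fun e => hρ_ne ((Real.sqrt_inj hρs.le hρss.le).1 e)
    rcases eq_or_mul_eq_of_shock_strength_diff_eq (Real.sqrt_pos.2 hρs) (Real.sqrt_pos.2 hρss)
      (Real.sqrt_pos.2 hρ) (Real.sqrt_pos.2 hρ₀) hsqrt
      ((shock_strength_diff_eq ha hρ h).trans (shock_strength_diff_eq ha hρ₀ h₀).symm)
      with e | e
    · exact Or.inl ((Real.sqrt_inj hρ.le hρ₀.le).1 e)
    · rw [← Real.sqrt_mul hρ.le, ← Real.sqrt_mul hρs.le,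
        Real.sqrt_inj (by positivity) (by positivity)] at e
      exact Or.inr ((eq_div_iff hρ₀.ne').2 e)
  · exact ⟨0, 0, fun ρ hρ => absurd ⟨ρ, hρ⟩ hex⟩
end

section
/- For each i ∈ {1,2}, if u_** = (ρ_**, q_**) is a state distinct from u_* lying on the i-th shock curve through u_* (i.e., q_** = S_i(ρ_**, u_*)), then {ρ > 0 : S_i(ρ, u_**) = S_i(ρ, u_*)} = {ρ_*, ρ_**}; that is, the two shock curves of the i-th family through u_* and through u_** intersect exactly at these two states. -/
/-- On square roots of densities, the difference of two shock curves of the same family factors. -/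
theorem Sc_sq_sub_Sc_sq (a : ℝ) (i : ℕ) {x y z : ℝ} (q : ℝ) (hx : 0 < x) (hy : 0 < y)
    (hz : 0 < z) :
    Sc a i (x ^ 2) (z ^ 2) (Sc a i (z ^ 2) (y ^ 2) q) - Sc a i (x ^ 2) (y ^ 2) q =
      (-1) ^ i * a * (x / (y * z)) * ((x - y) * (x - z) * (y - z)) := by
  simp only [Sc, ← div_pow, Real.sqrt_sq (div_pos hx hz).le, Real.sqrt_sq (div_pos hz hx).le,
    Real.sqrt_sq (div_pos hx hy).le, Real.sqrt_sq (div_pos hy hx).le,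
    Real.sqrt_sq (div_pos hz hy).le, Real.sqrt_sq (div_pos hy hz).le]
  field_simp
  ring

theorem Sc_self (a : ℝ) (i : ℕ) {ρ : ℝ} (q : ℝ) (hρ : 0 < ρ) : Sc a i ρ ρ q = q := by
  simp [Sc, mul_div_cancel₀ q hρ.ne', hρ.ne']

theorem shock_curves_through_point_intersection
    (a : ℝ) (ha : 0 < a) (i : ℕ) (hi : i ∈ ({1, 2} : Set ℕ))
    (ρs qs ρss qss : ℝ) (hρs : 0 < ρs) (hρss : 0 < ρss)
    (hne : (ρss, qss) ≠ (ρs, qs)) (hon : qss = Sc a i ρss ρs qs) :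
    {ρ : ℝ | 0 < ρ ∧ Sc a i ρ ρss qss = Sc a i ρ ρs qs} = {ρs, ρss} := by
  have hρ : ρss ≠ ρs := by
    rintro rfl
    exact hne (by rw [hon, Sc_self a i qs hρs])
  subst hon
  ext ρ
  simp only [Set.mem_ofPred_eq, Set.mem_insert_iff, Set.mem_singleton_iff]
  suffices h : 0 < ρ → (Sc a i ρ ρss (Sc a i ρss ρs qs) = Sc a i ρ ρs qs ↔ ρ = ρs ∨ ρ = ρss) by
    refine ⟨fun hρ' => (h hρ'.1).1 hρ'.2, fun hρ' => ?_⟩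
    have hpos : 0 < ρ := by rcases hρ' with rfl | rfl <;> assumption
    exact ⟨hpos, (h hpos).2 hρ'⟩
  intro hpos
  obtain ⟨x, hx, rfl⟩ : ∃ x : ℝ, 0 < x ∧ x ^ 2 = ρ :=
    ⟨√ρ, Real.sqrt_pos.2 hpos, Real.sq_sqrt hpos.le⟩
  obtain ⟨y, hy, rfl⟩ : ∃ y : ℝ, 0 < y ∧ y ^ 2 = ρs :=
    ⟨√ρs, Real.sqrt_pos.2 hρs, Real.sq_sqrt hρs.le⟩
  obtain ⟨z, hz, rfl⟩ : ∃ z : ℝ, 0 < z ∧ z ^ 2 = ρss :=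
    ⟨√ρss, Real.sqrt_pos.2 hρss, Real.sq_sqrt hρss.le⟩
  have hyz : y - z ≠ 0 := fun h => hρ (by rw [sub_eq_zero.1 h])
  have hc : (-1) ^ i * a * (x / (y * z)) ≠ 0 := by
    have : (-1 : ℝ) ^ i ≠ 0 := pow_ne_zero _ (by norm_num)
    positivity
  rw [← sub_eq_zero, Sc_sq_sub_Sc_sq a i qs hx hy hz, sq_eq_sq₀ hx.le hy.le,
    sq_eq_sq₀ hx.le hz.le]
  simp [hc, hyz, sub_eq_zero]
end

section
/- For any state u_*, the functions ρ ↦ R_1(ρ,u_*) and ρ ↦ S_1(ρ,u_*) are strictly concave on (0,∞), while the functions ρ ↦ R_2(ρ,u_*) and ρ ↦ S_2(ρ,u_*) are strictly convex on (0,∞). -/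
noncomputable def S1 (a ρ ρs qs : ℝ) : ℝ :=
  ρ * (qs/ρs - a * (Real.sqrt (ρ/ρs) - Real.sqrt (ρs/ρ)))

noncomputable def S2 (a ρ ρs qs : ℝ) : ℝ :=
  ρ * (qs/ρs + a * (Real.sqrt (ρ/ρs) - Real.sqrt (ρs/ρ)))

noncomputable def R1 (a ρ ρs qs : ℝ) : ℝ :=
  ρ * (qs/ρs - a * Real.log (ρ/ρs))

noncomputable def R2 (a ρ ρs qs : ℝ) : ℝ :=
  ρ * (qs/ρs + a * Real.log (ρ/ρs))

theorem StrictConvexOn.linear_add_const_mul {s : Set ℝ} {f : ℝ → ℝ} (hf : StrictConvexOn ℝ s f)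
    {a : ℝ} (ha : 0 < a) (m : ℝ) : StrictConvexOn ℝ s (fun x => m * x + a * f x) := by
  refine ⟨hf.1, fun x hx y hy hxy b c hb hc hbc => ?_⟩
  have h := mul_lt_mul_of_pos_left (hf.2 hx hy hxy hb hc hbc) ha
  simp only [smul_eq_mul] at h ⊢
  linarith

theorem strictConvexOn_mul_log_div {r : ℝ} (hr : 0 < r) :
    StrictConvexOn ℝ (Set.Ioi 0) (fun x => x * Real.log (x / r)) := by
  refine ((Real.strictConvexOn_mul_log.subset Set.Ioi_subset_Ici_self
    (convex_Ioi 0)).linear_add_const_mul one_pos (-Real.log r)).congr fun x hx => ?_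
  simp only [Real.log_div (ne_of_gt hx) hr.ne']
  ring

theorem strictConvexOn_mul_sqrt : StrictConvexOn ℝ (Set.Ici 0) (fun x => x * √x) := by
  refine (strictConvexOn_rpow (p := 1 + 1 / 2) (by norm_num)).congr fun x hx => ?_
  simp only [Real.sqrt_eq_rpow]
  rw [Real.rpow_add_of_nonneg hx zero_le_one (by norm_num), Real.rpow_one]

theorem strictConvexOn_mul_sqrt_div_sub_sqrt_div {r : ℝ} (hr : 0 < r) :
    StrictConvexOn ℝ (Set.Ioi 0) (fun x => x * (√(x / r) - √(r / x))) := by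
  have hs : 0 < √r := Real.sqrt_pos.mpr hr
  have h₁ := strictConvexOn_mul_sqrt.linear_add_const_mul (inv_pos.mpr hs) 0
  have h₂ := Real.strictConcaveOn_sqrt.neg.linear_add_const_mul hs 0
  refine ((h₁.add h₂).subset Set.Ioi_subset_Ici_self (convex_Ioi 0)).congr fun x hx => ?_
  have hx' : 0 < √x := Real.sqrt_pos.mpr hx
  simp only [Pi.add_apply, Pi.neg_apply, Real.sqrt_div (le_of_lt hx), Real.sqrt_div hr.le]
  field_simp
  linear_combination -√r ^ 2 * Real.sq_sqrt (le_of_lt hx)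

theorem curves_concavity_convexity
    (a : ℝ) (ha : 0 < a) (ρs qs : ℝ) (hρs : 0 < ρs) :
    StrictConcaveOn ℝ (Set.Ioi 0) (fun ρ => R1 a ρ ρs qs) ∧
    StrictConcaveOn ℝ (Set.Ioi 0) (fun ρ => S1 a ρ ρs qs) ∧
    StrictConvexOn ℝ (Set.Ioi 0) (fun ρ => R2 a ρ ρs qs) ∧
    StrictConvexOn ℝ (Set.Ioi 0) (fun ρ => S2 a ρ ρs qs) := by
  have hR := strictConvexOn_mul_log_div hρs
  have hS := strictConvexOn_mul_sqrt_div_sub_sqrt_div hρs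
  refine ⟨(hR.linear_add_const_mul ha (-(qs / ρs))).neg.congr fun x _ => ?_,
    (hS.linear_add_const_mul ha (-(qs / ρs))).neg.congr fun x _ => ?_,
    (hR.linear_add_const_mul ha (qs / ρs)).congr fun x _ => ?_,
    (hS.linear_add_const_mul ha (qs / ρs)).congr fun x _ => ?_⟩ <;>
  simp only [R1, R2, S1, S2, Pi.neg_apply] <;> ring
end

section
/- For any two states u_ℓ and u_r, there exists a unique ρ̃ > 0 such that FL_1(ρ̃, u_ℓ) = BL_2(ρ̃, u_r); that is, the forward 1-Lax curve through u_ℓ and the backward 2-Lax curve through u_r always meet, and at exactly one point (the intermediate state ũ(u_ℓ,u_r) of the Lax Riemann solver). -/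
noncomputable def FL1 (a ρ ρs qs : ℝ) : ℝ :=
  if ρ ≤ ρs then R1 a ρ ρs qs else S1 a ρ ρs qs

noncomputable def BL2 (a ρ ρs qs : ℝ) : ℝ :=
  if ρ ≤ ρs then R2 a ρ ρs qs else S2 a ρ ρs qs

/-- The velocity jump along a Lax curve, divided by the sound speed, as a function of the
logarithm of the density ratio. -/
noncomputable def laxProfile (y : ℝ) : ℝ :=
  if y ≤ 0 then y else 2 * Real.sinh (y / 2)

theorem continuous_laxProfile : Continuous laxProfile := by
  unfold laxProfile
  refine Continuous.if_le continuous_id (by fun_prop) continuous_id continuous_const ?_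
  rintro x rfl
  simp

theorem le_laxProfile (y : ℝ) : y ≤ laxProfile y := by
  unfold laxProfile
  split_ifs with h
  · exact le_rfl
  · have := Real.self_le_sinh_iff.2 (show 0 ≤ y / 2 by linarith)
    linarith

theorem laxProfile_of_nonpos {y : ℝ} (h : y ≤ 0) : laxProfile y = y := if_pos h

theorem strictMono_laxProfile : StrictMono laxProfile := by
  intro x y hxy
  by_cases hx : x ≤ 0
  · rw [laxProfile_of_nonpos hx]
    exact hxy.trans_le (le_laxProfile y)
  · have hy : ¬ y ≤ 0 := by linarith
    have := Real.sinh_lt_sinh.2 (show x / 2 < y / 2 by linarith)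
    simp only [laxProfile, if_neg hx, if_neg hy]
    linarith

theorem tendsto_laxProfile_atTop : Filter.Tendsto laxProfile Filter.atTop Filter.atTop :=
  Filter.tendsto_atTop_mono le_laxProfile Filter.tendsto_id

theorem tendsto_laxProfile_atBot : Filter.Tendsto laxProfile Filter.atBot Filter.atBot :=
  Filter.tendsto_id.congr' <| by
    filter_upwards [Filter.eventually_le_atBot 0] with y hy
    exact (laxProfile_of_nonpos hy).symm

theorem bijective_laxProfile_add (b c : ℝ) :
    Function.Bijective fun x => laxProfile (x - b) + laxProfile (x - c) := by
  refine ⟨StrictMono.injective fun x y h => ?_, Continuous.surjective ?_ ?_ ?_⟩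
  · exact add_lt_add (strictMono_laxProfile (by linarith)) (strictMono_laxProfile (by linarith))
  · exact (continuous_laxProfile.comp (by fun_prop)).add (continuous_laxProfile.comp (by fun_prop))
  · have h (d : ℝ) : Filter.Tendsto (fun x => laxProfile (x - d)) Filter.atTop Filter.atTop :=
      tendsto_laxProfile_atTop.comp (Filter.tendsto_atTop_add_const_right _ (-d) Filter.tendsto_id)
    exact (h b).atTop_add_atTop (h c)
  · have h (d : ℝ) : Filter.Tendsto (fun x => laxProfile (x - d)) Filter.atBot Filter.atBot :=
      tendsto_laxProfile_atBot.comp (Filter.tendsto_atBot_add_const_right _ (-d) Filter.tendsto_id)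
    exact (h b).atBot_add_atBot (h c)

theorem log_exp_div {x ρs : ℝ} (hs : 0 < ρs) :
    Real.log (Real.exp x / ρs) = x - Real.log ρs := by
  rw [Real.log_div (Real.exp_pos x).ne' hs.ne', Real.log_exp]

theorem sqrt_sub_sqrt_eq_sinh {x ρs : ℝ} (hs : 0 < ρs) :
    √(Real.exp x / ρs) - √(ρs / Real.exp x) = 2 * Real.sinh ((x - Real.log ρs) / 2) := by
  rw [Real.sinh_eq, ← neg_div, Real.exp_half, Real.exp_half, neg_sub, Real.exp_sub, Real.exp_sub,
    Real.exp_log hs]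
  ring

theorem FL1_exp (a x : ℝ) {ρs : ℝ} (qs : ℝ) (hs : 0 < ρs) :
    FL1 a (Real.exp x) ρs qs =
      Real.exp x * (qs / ρs - a * laxProfile (x - Real.log ρs)) := by
  simp only [FL1, R1, S1, laxProfile, log_exp_div hs, sqrt_sub_sqrt_eq_sinh hs, sub_nonpos,
    Real.le_log_iff_exp_le hs]
  split_ifs <;> rfl

theorem BL2_exp (a x : ℝ) {ρs : ℝ} (qs : ℝ) (hs : 0 < ρs) :
    BL2 a (Real.exp x) ρs qs =
      Real.exp x * (qs / ρs + a * laxProfile (x - Real.log ρs)) := by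
  simp only [BL2, R2, S2, laxProfile, log_exp_div hs, sqrt_sub_sqrt_eq_sinh hs, sub_nonpos,
    Real.le_log_iff_exp_le hs]
  split_ifs <;> rfl

theorem FL1_exp_eq_BL2_exp_iff {a : ℝ} (ha : 0 < a) (x : ℝ) {ρl ρr : ℝ} (ql qr : ℝ)
    (hρl : 0 < ρl) (hρr : 0 < ρr) :
    FL1 a (Real.exp x) ρl ql = BL2 a (Real.exp x) ρr qr ↔
      laxProfile (x - Real.log ρl) + laxProfile (x - Real.log ρr) = (ql / ρl - qr / ρr) / a := by
  rw [FL1_exp a x ql hρl, BL2_exp a x qr hρr, mul_right_inj' (Real.exp_pos x).ne',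
    eq_div_iff ha.ne']
  constructor <;> intro h <;> linarith

theorem lax_curves_meet_uniquely
    (a : ℝ) (ha : 0 < a) (ρl ql ρr qr : ℝ) (hρl : 0 < ρl) (hρr : 0 < ρr) :
    ∃! ρ : ℝ, 0 < ρ ∧ FL1 a ρ ρl ql = BL2 a ρ ρr qr := by
  obtain ⟨x, hx, hx_unique⟩ := (bijective_laxProfile_add (Real.log ρl) (Real.log ρr)).existsUnique
    ((ql / ρl - qr / ρr) / a)
  refine ⟨Real.exp x, ⟨Real.exp_pos x, (FL1_exp_eq_BL2_exp_iff ha x ql qr hρl hρr).2 hx⟩, ?_⟩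
  rintro ρ ⟨hρ, h⟩
  rw [← Real.exp_log hρ] at h ⊢
  rw [hx_unique _ ((FL1_exp_eq_BL2_exp_iff ha _ ql qr hρl hρr).1 h)]
end

section
/- Let u_ℓ be a state with subsonic-or-sonic-from-below velocity v_ℓ < a. Then ρ̄ = ρ_ℓ·e^{v_ℓ/a − 1} is the unique maximum point of ρ ↦ FL_1(ρ, u_ℓ) on (0,∞), and FL_1(ρ̄, u_ℓ) = a·ρ̄, i.e., the maximizing state is sonic. Symmetrically, if u_r is a state with v_r > −a, then ρ̲ = ρ_r·e^{−v_r/a − 1} is the unique minimum point of ρ ↦ BL_2(ρ, u_r) on (0,∞), and BL_2(ρ̲, u_r) = −a·ρ̲. -/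
theorem mul_sub_log_lt_exp_sub_one {m x : ℝ} (hx : 0 < x) (hne : x ≠ Real.exp (m - 1)) :
    x * (m - Real.log x) < Real.exp (m - 1) := by
  have hne' : m - 1 - Real.log x ≠ 0 := fun h => hne <| by
    rw [sub_eq_zero.mp h, Real.exp_log hx]
  have h := mul_lt_mul_of_pos_left (Real.add_one_lt_exp hne') hx
  rw [Real.exp_sub, Real.exp_log hx, mul_div_cancel₀ _ hx.ne'] at h
  linarith

theorem mul_sub_sqrt_sub_sqrt_inv_lt {m x : ℝ} (hm : m < 1) (hx : 1 < x) :
    x * (m - (√x - √x⁻¹)) < m := by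
  have hs : 1 < √x := Real.lt_sqrt_of_sq_lt (by simpa using hx)
  have hsq : √x ^ 2 = x := Real.sq_sqrt (by linarith)
  have hinv : x * √x⁻¹ = √x := by
    rw [Real.sqrt_inv]
    nth_rewrite 1 [← hsq]
    field_simp
  nlinarith [mul_pos (sub_pos.2 hx) (sub_pos.2 (hm.trans hs))]

theorem FL1_eq_mul {a ρ ρs : ℝ} (q : ℝ) (ha : 0 < a) (hs : 0 < ρs) :
    FL1 a ρ ρs q = a * ρs *
      if ρ / ρs ≤ 1 then ρ / ρs * (q / ρs / a - Real.log (ρ / ρs))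
      else ρ / ρs * (q / ρs / a - (√(ρ / ρs) - √(ρ / ρs)⁻¹)) := by
  simp only [FL1, R1, S1, div_le_one hs, inv_div]
  split_ifs <;> field_simp

theorem FL1_sonic {a ρs q : ℝ} (ha : 0 < a) (hs : 0 < ρs) (hv : q / ρs < a) :
    FL1 a (ρs * Real.exp (q / ρs / a - 1)) ρs q =
      a * (ρs * Real.exp (q / ρs / a - 1)) := by
  have hm : q / ρs / a < 1 := (div_lt_one ha).2 hv
  rw [FL1_eq_mul q ha hs, mul_div_cancel_left₀ _ hs.ne',
    if_pos (Real.exp_le_one_iff.2 (by linarith)), Real.log_exp]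
  ring

theorem FL1_lt_sonic {a ρ ρs q : ℝ} (ha : 0 < a) (hs : 0 < ρs) (hv : q / ρs < a)
    (hρ : 0 < ρ) (hne : ρ ≠ ρs * Real.exp (q / ρs / a - 1)) :
    FL1 a ρ ρs q < a * (ρs * Real.exp (q / ρs / a - 1)) := by
  have hm : q / ρs / a < 1 := (div_lt_one ha).2 hv
  rw [FL1_eq_mul q ha hs, ← mul_assoc]
  refine mul_lt_mul_of_pos_left ?_ (mul_pos ha hs)
  split_ifs with h
  · refine mul_sub_log_lt_exp_sub_one (div_pos hρ hs) fun h' => hne ?_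
    rw [← h', mul_div_cancel₀ _ hs.ne']
  · have := Real.add_one_le_exp (q / ρs / a - 1)
    linarith [mul_sub_sqrt_sub_sqrt_inv_lt hm (not_le.1 h)]

theorem BL2_eq_neg_FL1_neg (a ρ ρs q : ℝ) : BL2 a ρ ρs q = -FL1 a ρ ρs (-q) := by
  simp only [BL2, FL1, R1, R2, S1, S2]
  split_ifs <;> ring

theorem lax_curves_extrema_are_sonic (a : ℝ) (ha : 0 < a) :
    (∀ ρl ql : ℝ, 0 < ρl → ql/ρl < a →
      FL1 a (ρl * Real.exp (ql/ρl/a - 1)) ρl ql = a * (ρl * Real.exp (ql/ρl/a - 1)) ∧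
      ∀ ρ : ℝ, 0 < ρ → ρ ≠ ρl * Real.exp (ql/ρl/a - 1) →
        FL1 a ρ ρl ql < FL1 a (ρl * Real.exp (ql/ρl/a - 1)) ρl ql) ∧
    (∀ ρr qr : ℝ, 0 < ρr → -a < qr/ρr →
      BL2 a (ρr * Real.exp (-(qr/ρr)/a - 1)) ρr qr
        = -(a * (ρr * Real.exp (-(qr/ρr)/a - 1))) ∧
      ∀ ρ : ℝ, 0 < ρ → ρ ≠ ρr * Real.exp (-(qr/ρr)/a - 1) →
        BL2 a (ρr * Real.exp (-(qr/ρr)/a - 1)) ρr qr < BL2 a ρ ρr qr) := by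
  refine ⟨fun ρl ql hl hv => ?_, fun ρr qr hr hv => ?_⟩
  · refine ⟨FL1_sonic ha hl hv, fun ρ hρ hne => ?_⟩
    rw [FL1_sonic ha hl hv]
    exact FL1_lt_sonic ha hl hv hρ hne
  · have hv' : -qr / ρr < a := by rw [neg_div]; linarith
    simp only [BL2_eq_neg_FL1_neg, ← neg_div ρr qr, FL1_sonic ha hr hv']
    exact ⟨trivial, fun ρ hρ hne => neg_lt_neg (FL1_lt_sonic ha hr hv' hρ hne)⟩
end

section
/- Let ρ_0 > 0 and let u = (ρ, q) be a state with ρ > 0 satisfying a·ρ·log(ρ/ρ_0) ≤ q ≤ −a·ρ·log(ρ/ρ_0) (i.e., u belongs to the invariant domain I_{u_0} = {(ρ,q) : R_2(ρ,u_0) ≤ q ≤ R_1(ρ,u_0)} associated with the zero-momentum state u_0 = (ρ_0, 0)). Then ρ̂(u) ≤ ρ_0 and ρ̌(u) ≤ ρ_0; consequently the zero-momentum states (ρ̂(u), 0) and (ρ̌(u), 0) also belong to I_{u_0}. (This is the key step showing that I_{u_0} is invariant for the coupling Riemann solver of a closed valve.) -/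
noncomputable def rhoHat (a ρ q : ℝ) : ℝ :=
  if 0 < q/ρ then (ρ/(4*a^2)) * (Real.sqrt ((q/ρ)^2 + 4*a^2) + q/ρ)^2
  else ρ * Real.exp ((q/ρ)/a)

noncomputable def rhoCheck (a ρ q : ℝ) : ℝ :=
  if 0 < q/ρ then ρ * Real.exp (-(q/ρ)/a)
  else (ρ/(4*a^2)) * (Real.sqrt ((q/ρ)^2 + 4*a^2) - q/ρ)^2

lemma Real.add_sqrt_one_add_sq_le_exp {x : ℝ} (hx : 0 ≤ x) : x + √(1 + x ^ 2) ≤ Real.exp x := by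
  rw [← Real.exp_arsinh, Real.exp_le_exp, ← Real.sinh_le_sinh, Real.sinh_arsinh]
  exact Real.self_le_sinh_iff.mpr hx

lemma shock_density_le_rarefaction_density {a ρ v : ℝ} (ha : 0 < a) (hρ : 0 ≤ ρ) (hv : 0 ≤ v) :
    (ρ / (4 * a ^ 2)) * (√(v ^ 2 + 4 * a ^ 2) + v) ^ 2 ≤ ρ * Real.exp (v / a) := by
  have hsqrt : √(v ^ 2 + 4 * a ^ 2) = 2 * a * √(1 + (v / (2 * a)) ^ 2) := by
    rw [show v ^ 2 + 4 * a ^ 2 = (2 * a) ^ 2 * (1 + (v / (2 * a)) ^ 2) by field_simp; ring,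
      Real.sqrt_mul (sq_nonneg _), Real.sqrt_sq (by positivity)]
  have hle : v / (2 * a) + √(1 + (v / (2 * a)) ^ 2) ≤ Real.exp (v / (2 * a)) :=
    Real.add_sqrt_one_add_sq_le_exp (by positivity)
  calc (ρ / (4 * a ^ 2)) * (√(v ^ 2 + 4 * a ^ 2) + v) ^ 2
      = ρ * (v / (2 * a) + √(1 + (v / (2 * a)) ^ 2)) ^ 2 := by
        rw [hsqrt]
        generalize √(1 + (v / (2 * a)) ^ 2) = r
        field_simp
        ring
    _ ≤ ρ * Real.exp (v / (2 * a)) ^ 2 := by gcongr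
    _ = ρ * Real.exp (v / a) := by
        rw [← Real.exp_nat_mul]
        congr 2
        push_cast
        field_simp

lemma rhoHat_le {a ρ : ℝ} (q : ℝ) (ha : 0 < a) (hρ : 0 < ρ) :
    rhoHat a ρ q ≤ ρ * Real.exp (|q / ρ| / a) := by
  unfold rhoHat
  split_ifs with h
  · rw [abs_of_pos h]
    exact shock_density_le_rarefaction_density ha hρ.le h.le
  · gcongr
    exact le_abs_self _

lemma rhoHat_nonneg (a q : ℝ) {ρ : ℝ} (hρ : 0 < ρ) : 0 ≤ rhoHat a ρ q := by
  unfold rhoHat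
  split_ifs <;> positivity

lemma rhoCheck_eq_rhoHat_neg {a ρ q : ℝ} (ha : 0 < a) : rhoCheck a ρ q = rhoHat a ρ (-q) := by
  have hsqrt : √(4 * a ^ 2) = 2 * a := by
    rw [show 4 * a ^ 2 = (2 * a) ^ 2 by ring, Real.sqrt_sq (by positivity)]
  unfold rhoCheck rhoHat
  rw [neg_div ρ q]
  rcases lt_trichotomy (q / ρ) 0 with h | h | h
  · rw [if_neg h.not_gt, if_pos (neg_pos.mpr h), neg_sq, sub_eq_add_neg]
  · simp only [h, neg_zero, lt_irrefl, if_false]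
    rw [zero_div, Real.exp_zero, sub_zero, zero_pow two_ne_zero, zero_add, hsqrt]
    field_simp
    ring
  · rw [if_pos h, if_neg (by linarith)]

lemma mul_exp_abs_velocity_le {a ρ0 ρ q : ℝ} (ha : 0 < a) (hρ0 : 0 < ρ0) (hρ : 0 < ρ)
    (h1 : a * ρ * Real.log (ρ / ρ0) ≤ q) (h2 : q ≤ -(a * ρ * Real.log (ρ / ρ0))) :
    ρ * Real.exp (|q / ρ| / a) ≤ ρ0 := by
  have hv : |q / ρ| / a ≤ Real.log (ρ0 / ρ) := by
    rw [abs_div, abs_of_pos hρ, div_div, div_le_iff₀ (by positivity), ← inv_div ρ ρ0,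
      Real.log_inv, abs_le]
    constructor <;> linarith
  calc ρ * Real.exp (|q / ρ| / a) ≤ ρ * Real.exp (Real.log (ρ0 / ρ)) := by gcongr
    _ = ρ0 := by rw [Real.exp_log (by positivity)]; field_simp

lemma mul_log_div_nonpos {a ρ0 r : ℝ} (ha : 0 < a) (hρ0 : 0 < ρ0) (hr : 0 ≤ r) (h : r ≤ ρ0) :
    a * r * Real.log (r / ρ0) ≤ 0 :=
  mul_nonpos_of_nonneg_of_nonpos (by positivity)
    (Real.log_nonpos (by positivity) ((div_le_one hρ0).mpr h))

theorem invariant_domain_closed_valve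
    (a : ℝ) (ha : 0 < a) (ρ0 : ℝ) (hρ0 : 0 < ρ0) (ρ q : ℝ) (hρ : 0 < ρ)
    (h1 : a * ρ * Real.log (ρ/ρ0) ≤ q) (h2 : q ≤ -(a * ρ * Real.log (ρ/ρ0))) :
    rhoHat a ρ q ≤ ρ0 ∧ rhoCheck a ρ q ≤ ρ0 ∧
    (a * rhoHat a ρ q * Real.log (rhoHat a ρ q / ρ0) ≤ 0 ∧
      0 ≤ -(a * rhoHat a ρ q * Real.log (rhoHat a ρ q / ρ0))) ∧
    (a * rhoCheck a ρ q * Real.log (rhoCheck a ρ q / ρ0) ≤ 0 ∧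
      0 ≤ -(a * rhoCheck a ρ q * Real.log (rhoCheck a ρ q / ρ0))) := by
  have hbound := mul_exp_abs_velocity_le ha hρ0 hρ h1 h2
  have hhat : rhoHat a ρ q ≤ ρ0 := (rhoHat_le q ha hρ).trans hbound
  have hcheck : rhoCheck a ρ q ≤ ρ0 := by
    rw [rhoCheck_eq_rhoHat_neg ha]
    refine (rhoHat_le (-q) ha hρ).trans ?_
    rwa [neg_div, abs_neg]
  have hhat_log := mul_log_div_nonpos ha hρ0 (rhoHat_nonneg a q hρ) hhat
  have hcheck_log := mul_log_div_nonpos ha hρ0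
    (rhoCheck_eq_rhoHat_neg (ρ := ρ) (q := q) ha ▸ rhoHat_nonneg a (-q) hρ) hcheck
  exact ⟨hhat, hcheck, ⟨hhat_log, neg_nonneg.mpr hhat_log⟩,
    ⟨hcheck_log, neg_nonneg.mpr hcheck_log⟩⟩
end

section
/- For any state u_ℓ, the velocity function ρ ↦ FL_1(ρ, u_ℓ)/ρ is strictly decreasing on (0,∞), tends to +∞ as ρ → 0⁺ and tends to −∞ as ρ → ∞; for any state u_r, the velocity function ρ ↦ BL_2(ρ, u_r)/ρ is strictly increasing on (0,∞), tends to −∞ as ρ → 0⁺ and tends to +∞ as ρ → ∞. -/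
/-- The normalized velocity increment across a Lax curve, as a function of the density ratio. -/
noncomputable def laxIncrement (t : ℝ) : ℝ :=
  if t ≤ 1 then Real.log t else Real.sqrt t - Real.sqrt t⁻¹

theorem strictMonoOn_laxIncrement : StrictMonoOn laxIncrement (Set.Ioi 0) := by
  have shock_lt : ∀ {x y : ℝ}, 0 < x → x < y →
      Real.sqrt x - Real.sqrt x⁻¹ < Real.sqrt y - Real.sqrt y⁻¹ := by
    intro x y hx hxy
    have h₁ := Real.sqrt_lt_sqrt hx.le hxy
    have h₂ := Real.sqrt_le_sqrt (inv_anti₀ hx hxy.le)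
    linarith
  intro x hx y _ hxy
  rw [Set.mem_Ioi] at hx
  unfold laxIncrement
  split_ifs with h₁ h₂ h₂
  · exact Real.log_lt_log hx hxy
  · have h₃ := Real.log_nonpos hx.le h₁
    have h₄ := shock_lt one_pos (not_le.mp h₂)
    simp only [inv_one, sub_self] at h₄
    linarith
  · linarith
  · exact shock_lt hx hxy

theorem tendsto_laxIncrement_nhdsGT_zero :
    Filter.Tendsto laxIncrement (nhdsWithin 0 (Set.Ioi 0)) Filter.atBot := by
  refine Real.tendsto_log_nhdsGT_zero.congr' ?_
  filter_upwards [Ioo_mem_nhdsGT (zero_lt_one' ℝ)] with t ht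
  simp [laxIncrement, ht.2.le]

theorem tendsto_laxIncrement_atTop :
    Filter.Tendsto laxIncrement Filter.atTop Filter.atTop := by
  refine Filter.tendsto_atTop_mono' _ ?_
    (Filter.tendsto_atTop_add_const_right _ (-1) Real.tendsto_sqrt_atTop)
  filter_upwards [Filter.eventually_gt_atTop 1] with t ht
  have h : Real.sqrt t⁻¹ ≤ 1 := Real.sqrt_le_one.mpr (inv_le_one_of_one_le₀ ht.le)
  simp only [laxIncrement, not_le.mpr ht, if_false]
  linarith

theorem FL1_div_eq {ρ ρs : ℝ} (a qs : ℝ) (hρ : 0 < ρ) (hρs : 0 < ρs) :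
    FL1 a ρ ρs qs / ρ = qs / ρs - a * laxIncrement (ρ / ρs) := by
  unfold FL1 R1 S1 laxIncrement
  simp only [div_le_one hρs, inv_div]
  split_ifs <;> exact mul_div_cancel_left₀ _ hρ.ne'

theorem BL2_div_eq {ρ ρs : ℝ} (a qs : ℝ) (hρ : 0 < ρ) (hρs : 0 < ρs) :
    BL2 a ρ ρs qs / ρ = qs / ρs + a * laxIncrement (ρ / ρs) := by
  unfold BL2 R2 S2 laxIncrement
  simp only [div_le_one hρs, inv_div]
  split_ifs <;> exact mul_div_cancel_left₀ _ hρ.ne'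

theorem tendsto_div_const_nhdsGT_zero {c : ℝ} (hc : 0 < c) :
    Filter.Tendsto (fun x : ℝ => x / c) (nhdsWithin 0 (Set.Ioi 0))
      (nhdsWithin 0 (Set.Ioi 0)) := by
  refine tendsto_nhdsWithin_iff.mpr ⟨?_, ?_⟩
  · have h : Filter.Tendsto (fun x : ℝ => x / c) (nhds 0) (nhds (0 / c)) :=
      Filter.tendsto_id.div_const c
    rw [zero_div] at h
    exact h.mono_left nhdsWithin_le_nhds
  · filter_upwards [self_mem_nhdsWithin] with x hx
    exact div_pos hx hc

theorem lax_velocity_monotone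
    (a : ℝ) (ha : 0 < a) (ρl ql ρr qr : ℝ) (hρl : 0 < ρl) (hρr : 0 < ρr) :
    StrictAntiOn (fun ρ => FL1 a ρ ρl ql / ρ) (Set.Ioi 0) ∧
    Filter.Tendsto (fun ρ => FL1 a ρ ρl ql / ρ) (nhdsWithin 0 (Set.Ioi 0)) Filter.atTop ∧
    Filter.Tendsto (fun ρ => FL1 a ρ ρl ql / ρ) Filter.atTop Filter.atBot ∧
    StrictMonoOn (fun ρ => BL2 a ρ ρr qr / ρ) (Set.Ioi 0) ∧
    Filter.Tendsto (fun ρ => BL2 a ρ ρr qr / ρ) (nhdsWithin 0 (Set.Ioi 0)) Filter.atBot ∧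
    Filter.Tendsto (fun ρ => BL2 a ρ ρr qr / ρ) Filter.atTop Filter.atTop := by
  have increment_lt : ∀ {c x y : ℝ}, 0 < c → 0 < x → 0 < y → x < y →
      a * laxIncrement (x / c) < a * laxIncrement (y / c) := fun hc hx hy hxy =>
    mul_lt_mul_of_pos_left (strictMonoOn_laxIncrement (div_pos hx hc) (div_pos hy hc)
      (div_lt_div_of_pos_right hxy hc)) ha
  have increment_zero : ∀ {c : ℝ}, 0 < c → Filter.Tendsto (fun ρ => a * laxIncrement (ρ / c))
      (nhdsWithin 0 (Set.Ioi 0)) Filter.atBot := fun hc =>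
    (tendsto_laxIncrement_nhdsGT_zero.comp (tendsto_div_const_nhdsGT_zero hc)).const_mul_atBot ha
  have increment_top : ∀ {c : ℝ}, 0 < c → Filter.Tendsto (fun ρ => a * laxIncrement (ρ / c))
      Filter.atTop Filter.atTop := fun hc =>
    (tendsto_laxIncrement_atTop.comp (Filter.tendsto_id.atTop_div_const hc)).const_mul_atTop ha
  refine ⟨?_, ?_, ?_, ?_, ?_, ?_⟩
  · intro x hx y hy hxy
    simp only [FL1_div_eq a ql hx hρl, FL1_div_eq a ql hy hρl]
    exact sub_lt_sub_left (increment_lt hρl hx hy hxy) _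
  · refine (Filter.tendsto_atTop_add_const_left _ (ql / ρl)
      (Filter.tendsto_neg_atBot_atTop.comp (increment_zero hρl))).congr' ?_
    filter_upwards [self_mem_nhdsWithin] with ρ hρ
    rw [FL1_div_eq a ql hρ hρl, sub_eq_add_neg, Function.comp_apply]
  · refine (Filter.tendsto_atBot_add_const_left _ (ql / ρl)
      (Filter.tendsto_neg_atTop_atBot.comp (increment_top hρl))).congr' ?_
    filter_upwards [Filter.eventually_gt_atTop 0] with ρ hρ
    rw [FL1_div_eq a ql hρ hρl, sub_eq_add_neg, Function.comp_apply]
  · intro x hx y hy hxy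
    simp only [BL2_div_eq a qr hx hρr, BL2_div_eq a qr hy hρr]
    exact add_lt_add_right (increment_lt hρr hx hy hxy) _
  · refine (Filter.tendsto_atBot_add_const_left _ (qr / ρr) (increment_zero hρr)).congr' ?_
    filter_upwards [self_mem_nhdsWithin] with ρ hρ
    rw [BL2_div_eq a qr hρ hρr]
  · refine (Filter.tendsto_atTop_add_const_left _ (qr / ρr) (increment_top hρr)).congr' ?_
    filter_upwards [Filter.eventually_gt_atTop 0] with ρ hρ
    rw [BL2_div_eq a qr hρ hρr]
end
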